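/- arXiv:1710.02739 — 2 statements merged into one kernel-verified Lean document; each statement's English description precedes it below -/
import Mathlib

section
/- Let s ∈ {1,−1}, e ∈ {1,−1}, let p be a positive integer, and let v : ℝ³ → ℝ be a smooth function of (t,x,y) solving the 2D gB potential equation v_{tt} = v_{xx} + (p+1)(v_x)^p v_{xx} + e·v_{xxxx} + s·v_{yy} at every point. Define T = v_y·v_t, X = −(v_x^{p+1} + e·v_{xxx} + v_x)·v_y + e·v_{xy}·v_{xx}, Y = v_x^{p+2}/(p+2) + (1/2)(−e·v_{xx}² + v_x² − s·v_y² − v_t²). Then ∂_t T + ∂_x X + ∂_y Y = 0 at every point (this is the y-momentum conservation law of the 2D generalized Boussinesq equation, arising from y-translation invariance). -/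
/-- Partial derivative with respect to the first (time) variable. -/
noncomputable def pdt (v : ℝ → ℝ → ℝ → ℝ) (t x y : ℝ) : ℝ :=
  deriv (fun t' => v t' x y) t

/-- Partial derivative with respect to the second (x) variable. -/
noncomputable def pdx (v : ℝ → ℝ → ℝ → ℝ) (t x y : ℝ) : ℝ :=
  deriv (fun x' => v t x' y) x

/-- Partial derivative with respect to the third (y) variable. -/
noncomputable def pdy (v : ℝ → ℝ → ℝ → ℝ) (t x y : ℝ) : ℝ :=
  deriv (fun y' => v t x y') y


/-- A function of three real variables that is jointly smooth. -/
def JointlySmooth (u : ℝ → ℝ → ℝ → ℝ) : Prop :=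
  ContDiff ℝ (⊤ : ℕ∞) (fun q : ℝ × ℝ × ℝ => u q.1 q.2.1 q.2.2)

theorem contDiff_fderiv_apply {E : Type*} [NormedAddCommGroup E] [NormedSpace ℝ E] {F : E → ℝ}
    (hF : ContDiff ℝ (⊤ : ℕ∞) F) (d : E) : ContDiff ℝ (⊤ : ℕ∞) (fun q => fderiv ℝ F q d) :=
  (hF.fderiv_right (m := (⊤ : ℕ∞)) (by simp)).clm_apply contDiff_const

theorem fderiv_fderiv_apply_comm {E : Type*} [NormedAddCommGroup E] [NormedSpace ℝ E] {F : E → ℝ}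
    (hF : ContDiff ℝ (⊤ : ℕ∞) F) (a b q : E) :
    fderiv ℝ (fun z => fderiv ℝ F z a) q b = fderiv ℝ (fun z => fderiv ℝ F z b) q a := by
  have hd : DifferentiableAt ℝ (fderiv ℝ F) q :=
    (hF.fderiv_right (m := (⊤ : ℕ∞)) (by simp)).differentiable (by simp) q
  have hsymm : IsSymmSndFDerivAt ℝ F q := hF.contDiffAt.isSymmSndFDerivAt
    (by simpa using! WithTop.coe_le_coe.2 (le_top : (2 : ℕ∞) ≤ ⊤))
  rw [fderiv_clm_apply hd (differentiableAt_const a), fderiv_clm_apply hd (differentiableAt_const b)]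
  simpa using hsymm.eq b a

namespace JointlySmooth

variable {u : ℝ → ℝ → ℝ → ℝ}

theorem hasFDerivAt (hu : JointlySmooth u) (q : ℝ × ℝ × ℝ) :
    HasFDerivAt (fun q : ℝ × ℝ × ℝ => u q.1 q.2.1 q.2.2)
      (fderiv ℝ (fun q : ℝ × ℝ × ℝ => u q.1 q.2.1 q.2.2) q) q :=
  (ContDiff.differentiable hu (by simp) q).hasFDerivAt

theorem hasDerivAt_t_fderiv (hu : JointlySmooth u) (t x y : ℝ) :
    HasDerivAt (fun t' => u t' x y)
      (fderiv ℝ (fun q : ℝ × ℝ × ℝ => u q.1 q.2.1 q.2.2) (t, x, y) (1, 0, 0)) t :=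
  HasFDerivAt.comp_hasDerivAt (f := fun t' => (t', x, y)) t
    (hu.hasFDerivAt (t, x, y))
    ((hasDerivAt_id t).prodMk ((hasDerivAt_const t x).prodMk (hasDerivAt_const t y)))

theorem hasDerivAt_pdt (hu : JointlySmooth u) (t x y : ℝ) :
    HasDerivAt (fun t' => u t' x y) (_root_.pdt u t x y) t :=
  (hu.hasDerivAt_t_fderiv t x y).differentiableAt.hasDerivAt

theorem pdt_eq_fderiv (hu : JointlySmooth u) (t x y : ℝ) :
    _root_.pdt u t x y =
      fderiv ℝ (fun q : ℝ × ℝ × ℝ => u q.1 q.2.1 q.2.2) (t, x, y) (1, 0, 0) :=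
  (hu.hasDerivAt_t_fderiv t x y).deriv

theorem pdt (hu : JointlySmooth u) : JointlySmooth (_root_.pdt u) := by
  simpa only [JointlySmooth, hu.pdt_eq_fderiv] using contDiff_fderiv_apply hu (1, 0, 0)

theorem hasDerivAt_x_fderiv (hu : JointlySmooth u) (t x y : ℝ) :
    HasDerivAt (fun x' => u t x' y)
      (fderiv ℝ (fun q : ℝ × ℝ × ℝ => u q.1 q.2.1 q.2.2) (t, x, y) (0, 1, 0)) x :=
  HasFDerivAt.comp_hasDerivAt (f := fun x' => (t, x', y)) x
    (hu.hasFDerivAt (t, x, y))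
    ((hasDerivAt_const x t).prodMk ((hasDerivAt_id x).prodMk (hasDerivAt_const x y)))

theorem hasDerivAt_pdx (hu : JointlySmooth u) (t x y : ℝ) :
    HasDerivAt (fun x' => u t x' y) (_root_.pdx u t x y) x :=
  (hu.hasDerivAt_x_fderiv t x y).differentiableAt.hasDerivAt

theorem pdx_eq_fderiv (hu : JointlySmooth u) (t x y : ℝ) :
    _root_.pdx u t x y =
      fderiv ℝ (fun q : ℝ × ℝ × ℝ => u q.1 q.2.1 q.2.2) (t, x, y) (0, 1, 0) :=
  (hu.hasDerivAt_x_fderiv t x y).deriv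

theorem pdx (hu : JointlySmooth u) : JointlySmooth (_root_.pdx u) := by
  simpa only [JointlySmooth, hu.pdx_eq_fderiv] using contDiff_fderiv_apply hu (0, 1, 0)

theorem hasDerivAt_y_fderiv (hu : JointlySmooth u) (t x y : ℝ) :
    HasDerivAt (fun y' => u t x y')
      (fderiv ℝ (fun q : ℝ × ℝ × ℝ => u q.1 q.2.1 q.2.2) (t, x, y) (0, 0, 1)) y :=
  HasFDerivAt.comp_hasDerivAt (f := fun y' => (t, x, y')) y
    (hu.hasFDerivAt (t, x, y))
    ((hasDerivAt_const y t).prodMk ((hasDerivAt_const y x).prodMk (hasDerivAt_id y)))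

theorem hasDerivAt_pdy (hu : JointlySmooth u) (t x y : ℝ) :
    HasDerivAt (fun y' => u t x y') (_root_.pdy u t x y) y :=
  (hu.hasDerivAt_y_fderiv t x y).differentiableAt.hasDerivAt

theorem pdy_eq_fderiv (hu : JointlySmooth u) (t x y : ℝ) :
    _root_.pdy u t x y =
      fderiv ℝ (fun q : ℝ × ℝ × ℝ => u q.1 q.2.1 q.2.2) (t, x, y) (0, 0, 1) :=
  (hu.hasDerivAt_y_fderiv t x y).deriv

theorem pdy (hu : JointlySmooth u) : JointlySmooth (_root_.pdy u) := by
  simpa only [JointlySmooth, hu.pdy_eq_fderiv] using contDiff_fderiv_apply hu (0, 0, 1)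

theorem pdt_pdy_comm (hu : JointlySmooth u) (t x y : ℝ) :
    _root_.pdt (_root_.pdy u) t x y = _root_.pdy (_root_.pdt u) t x y := by
  rw [hu.pdy.pdt_eq_fderiv, hu.pdt.pdy_eq_fderiv]
  simp only [hu.pdy_eq_fderiv, hu.pdt_eq_fderiv]
  exact fderiv_fderiv_apply_comm hu _ _ _

theorem pdx_pdy_comm (hu : JointlySmooth u) (t x y : ℝ) :
    _root_.pdx (_root_.pdy u) t x y = _root_.pdy (_root_.pdx u) t x y := by
  rw [hu.pdy.pdx_eq_fderiv, hu.pdx.pdy_eq_fderiv]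
  simp only [hu.pdy_eq_fderiv, hu.pdx_eq_fderiv]
  exact fderiv_fderiv_apply_comm hu _ _ _

end JointlySmooth

/-- y-momentum conservation law of the 2D generalized Boussinesq equation. -/
theorem gb_y_momentum_conservation
    (s : ℝ) (hs : s = 1 ∨ s = -1)
    (e : ℝ) (he : e = 1 ∨ e = -1)
    (p : ℕ) (hp : 1 ≤ p)
    (v : ℝ → ℝ → ℝ → ℝ)
    (hv : ContDiff ℝ (⊤ : ℕ∞) (fun q : ℝ × ℝ × ℝ => v q.1 q.2.1 q.2.2))
    (hsol : ∀ t x y : ℝ,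
      pdt (pdt v) t x y = pdx (pdx v) t x y
        + ((p : ℝ) + 1) * (pdx v t x y) ^ p * pdx (pdx v) t x y
        + e * pdx (pdx (pdx (pdx v))) t x y + s * pdy (pdy v) t x y)
    (T X Y : ℝ → ℝ → ℝ → ℝ)
    (hT : ∀ t x y : ℝ, T t x y = pdy v t x y * pdt v t x y)
    (hX : ∀ t x y : ℝ, X t x y =
      -((pdx v t x y) ^ (p+1) + e * pdx (pdx (pdx v)) t x y + pdx v t x y) * pdy v t x y
        + e * pdy (pdx v) t x y * pdx (pdx v) t x y)
    (hY : ∀ t x y : ℝ, Y t x y =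
      (pdx v t x y) ^ (p+2) / ((p : ℝ) + 2)
        + (1/2) * (- e * (pdx (pdx v) t x y) ^ 2 + (pdx v t x y) ^ 2
          - s * (pdy v t x y) ^ 2 - (pdt v t x y) ^ 2)) :
    ∀ t x y : ℝ, pdt T t x y + pdx X t x y + pdy Y t x y = 0 := by
  intro t x y
  have hv : JointlySmooth v := hv
  have hTt : HasDerivAt (fun t' => T t' x y)
      (pdt (pdy v) t x y * pdt v t x y + pdy v t x y * pdt (pdt v) t x y) t := by
    simp only [hT]
    exact (hv.pdy.hasDerivAt_pdt t x y).mul (hv.pdt.hasDerivAt_pdt t x y)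
  have hvx := hv.pdx.hasDerivAt_pdx t x y
  have hXx := (((((hvx.pow (p + 1)).add
    ((hv.pdx.pdx.pdx.hasDerivAt_pdx t x y).const_mul e)).add hvx).neg.mul
      (hv.pdy.hasDerivAt_pdx t x y)).add
    (((hv.pdx.pdy.hasDerivAt_pdx t x y).const_mul e).mul (hv.pdx.pdx.hasDerivAt_pdx t x y)))
  have hvxy := hv.pdx.hasDerivAt_pdy t x y
  have hYy := ((hvxy.pow (p + 2)).div_const ((p : ℝ) + 2)).add
    ((((((hv.pdx.pdx.hasDerivAt_pdy t x y).pow 2).const_mul (-e)).add (hvxy.pow 2)).sub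
      (((hv.pdy.hasDerivAt_pdy t x y).pow 2).const_mul s)).sub
      ((hv.pdt.hasDerivAt_pdy t x y).pow 2) |>.const_mul (1 / 2))
  have eT : pdt T t x y = _ := hTt.deriv
  have eX : pdx X t x y = _ :=
    (hXx.congr_of_eventuallyEq (.of_forall fun x' => hX t x' y)).deriv
  have eY : pdy Y t x y = _ :=
    (hYy.congr_of_eventuallyEq (.of_forall fun y' => hY t x y')).deriv
  rw [eT, eX, eY, hv.pdt_pdy_comm, hv.pdx_pdy_comm, hv.pdx.pdx_pdy_comm, hsol]
  have hp2 : (p : ℝ) + 2 ≠ 0 := by positivity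
  simp
  field_simp
  ring
end

section
/- Let e ∈ {1,−1}, let p be a positive integer, let ε ∈ ℝ, and let v : ℝ³ → ℝ be a smooth function of (t,x,y) solving the 2D gB potential equation with s = 1, i.e. v_{tt} = v_{xx} + (p+1)(v_x)^p v_{xx} + e·v_{xxxx} + v_{yy}, at every point. Then the function ṽ(t,x,y) := v(cosh(ε)·t + sinh(ε)·y, x, cosh(ε)·y + sinh(ε)·t) also solves this equation at every point. (This is the one-parameter boost symmetry group in the (y,t)-plane of the 2D generalized Boussinesq equation in the case σ² = 1.) -/
theorem hasDerivAt_comp_of_contDiff {v : ℝ → ℝ → ℝ → ℝ}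
    (hv : ContDiff ℝ (⊤ : ℕ∞) (fun q : ℝ × ℝ × ℝ => v q.1 q.2.1 q.2.2))
    {f g : ℝ → ℝ} {f' g' r : ℝ} (x : ℝ) (hf : HasDerivAt f f' r) (hg : HasDerivAt g g' r) :
    HasDerivAt (fun r => v (f r) x (g r))
      (fderiv ℝ (fun q : ℝ × ℝ × ℝ => v q.1 q.2.1 q.2.2) (f r, x, g r) (f', 0, g')) r :=
  HasFDerivAt.comp_hasDerivAt (f := fun r => (f r, x, g r)) r
    (hv.differentiable (by simp) _).hasFDerivAt
    (hf.prodMk ((hasDerivAt_const r x).prodMk hg))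

theorem pdt_eq_fderiv {v : ℝ → ℝ → ℝ → ℝ}
    (hv : ContDiff ℝ (⊤ : ℕ∞) (fun q : ℝ × ℝ × ℝ => v q.1 q.2.1 q.2.2)) (t x y : ℝ) :
    pdt v t x y = fderiv ℝ (fun q : ℝ × ℝ × ℝ => v q.1 q.2.1 q.2.2) (t, x, y) (1, 0, 0) :=
  (hasDerivAt_comp_of_contDiff hv x (hasDerivAt_id t) (hasDerivAt_const t y)).deriv

theorem pdy_eq_fderiv {v : ℝ → ℝ → ℝ → ℝ}
    (hv : ContDiff ℝ (⊤ : ℕ∞) (fun q : ℝ × ℝ × ℝ => v q.1 q.2.1 q.2.2)) (t x y : ℝ) :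
    pdy v t x y = fderiv ℝ (fun q : ℝ × ℝ × ℝ => v q.1 q.2.1 q.2.2) (t, x, y) (0, 0, 1) :=
  (hasDerivAt_comp_of_contDiff hv x (hasDerivAt_const y t) (hasDerivAt_id y)).deriv

theorem contDiff_pdt {v : ℝ → ℝ → ℝ → ℝ}
    (hv : ContDiff ℝ (⊤ : ℕ∞) (fun q : ℝ × ℝ × ℝ => v q.1 q.2.1 q.2.2)) :
    ContDiff ℝ (⊤ : ℕ∞) (fun q : ℝ × ℝ × ℝ => pdt v q.1 q.2.1 q.2.2) := by
  simp only [pdt_eq_fderiv hv]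
  exact (hv.fderiv_right (m := (⊤ : ℕ∞)) (by simp)).clm_apply contDiff_const

theorem contDiff_pdy {v : ℝ → ℝ → ℝ → ℝ}
    (hv : ContDiff ℝ (⊤ : ℕ∞) (fun q : ℝ × ℝ × ℝ => v q.1 q.2.1 q.2.2)) :
    ContDiff ℝ (⊤ : ℕ∞) (fun q : ℝ × ℝ × ℝ => pdy v q.1 q.2.1 q.2.2) := by
  simp only [pdy_eq_fderiv hv]
  exact (hv.fderiv_right (m := (⊤ : ℕ∞)) (by simp)).clm_apply contDiff_const

/-- Chain rule along a curve in the `(t,y)`-plane, in terms of partial derivatives. -/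
theorem hasDerivAt_comp_pdt_pdy {v : ℝ → ℝ → ℝ → ℝ}
    (hv : ContDiff ℝ (⊤ : ℕ∞) (fun q : ℝ × ℝ × ℝ => v q.1 q.2.1 q.2.2))
    {f g : ℝ → ℝ} {f' g' r : ℝ} (x : ℝ) (hf : HasDerivAt f f' r) (hg : HasDerivAt g g' r) :
    HasDerivAt (fun r => v (f r) x (g r))
      (f' * pdt v (f r) x (g r) + g' * pdy v (f r) x (g r)) r := by
  convert hasDerivAt_comp_of_contDiff hv x hf hg using 1
  rw [pdt_eq_fderiv hv, pdy_eq_fderiv hv, ← smul_eq_mul, ← smul_eq_mul, ← map_smul, ← map_smul,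
    ← map_add]
  simp

/-- The time derivative of a function composed with a linear map of the `(t,y)`-plane. -/
theorem hasDerivAt_boost_time {v : ℝ → ℝ → ℝ → ℝ}
    (hv : ContDiff ℝ (⊤ : ℕ∞) (fun q : ℝ × ℝ × ℝ => v q.1 q.2.1 q.2.2)) (c s t x y : ℝ) :
    HasDerivAt (fun r => v (c * r + s * y) x (c * y + s * r))
      (c * pdt v (c * t + s * y) x (c * y + s * t)
        + s * pdy v (c * t + s * y) x (c * y + s * t)) t :=
  hasDerivAt_comp_pdt_pdy hv x
    (by simpa using ((hasDerivAt_id t).const_mul c).add_const (s * y))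
    (by simpa using ((hasDerivAt_id t).const_mul s).const_add (c * y))

/-- The `y` derivative of a function composed with a linear map of the `(t,y)`-plane. -/
theorem hasDerivAt_boost_space {v : ℝ → ℝ → ℝ → ℝ}
    (hv : ContDiff ℝ (⊤ : ℕ∞) (fun q : ℝ × ℝ × ℝ => v q.1 q.2.1 q.2.2)) (c s t x y : ℝ) :
    HasDerivAt (fun r => v (c * t + s * r) x (c * r + s * t))
      (s * pdt v (c * t + s * y) x (c * y + s * t)
        + c * pdy v (c * t + s * y) x (c * y + s * t)) y :=
  hasDerivAt_comp_pdt_pdy hv x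
    (by simpa using ((hasDerivAt_id y).const_mul s).const_add (c * t))
    (by simpa using ((hasDerivAt_id y).const_mul c).add_const (s * t))

/-- One-parameter boost symmetry group in the `(y,t)`-plane of the
2D generalized Boussinesq equation in the case `σ² = 1`. -/
theorem gb_boost_symmetry
    (e : ℝ) (he : e = 1 ∨ e = -1)
    (p : ℕ) (hp : 1 ≤ p)
    (ε : ℝ)
    (v : ℝ → ℝ → ℝ → ℝ)
    (hv : ContDiff ℝ (⊤ : ℕ∞) (fun q : ℝ × ℝ × ℝ => v q.1 q.2.1 q.2.2))
    (hsol : ∀ t x y : ℝ,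
      pdt (pdt v) t x y = pdx (pdx v) t x y
        + ((p : ℝ) + 1) * (pdx v t x y) ^ p * pdx (pdx v) t x y
        + e * pdx (pdx (pdx (pdx v))) t x y + pdy (pdy v) t x y)
    (w : ℝ → ℝ → ℝ → ℝ)
    (hw : ∀ t x y : ℝ, w t x y =
      v (Real.cosh ε * t + Real.sinh ε * y) x (Real.cosh ε * y + Real.sinh ε * t)) :
    ∀ t x y : ℝ,
      pdt (pdt w) t x y = pdx (pdx w) t x y
        + ((p : ℝ) + 1) * (pdx w t x y) ^ p * pdx (pdx w) t x y
        + e * pdx (pdx (pdx (pdx w))) t x y + pdy (pdy w) t x y := by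
  intro t x y
  obtain rfl : w = fun t x y =>
      v (Real.cosh ε * t + Real.sinh ε * y) x (Real.cosh ε * y + Real.sinh ε * t) := by
    funext t x y
    exact hw t x y
  have hcs := Real.cosh_sq ε
  set c := Real.cosh ε
  set s := Real.sinh ε
  have ht : pdt (fun t x y => v (c * t + s * y) x (c * y + s * t)) = fun t x y =>
      c * pdt v (c * t + s * y) x (c * y + s * t)
        + s * pdy v (c * t + s * y) x (c * y + s * t) := by
    funext t x y
    exact (hasDerivAt_boost_time hv c s t x y).deriv
  have hy : pdy (fun t x y => v (c * t + s * y) x (c * y + s * t)) = fun t x y =>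
      s * pdt v (c * t + s * y) x (c * y + s * t)
        + c * pdy v (c * t + s * y) x (c * y + s * t) := by
    funext t x y
    exact (hasDerivAt_boost_space hv c s t x y).deriv
  have htt := (((hasDerivAt_boost_time (contDiff_pdt hv) c s t x y).const_mul c).add
    ((hasDerivAt_boost_time (contDiff_pdy hv) c s t x y).const_mul s)).deriv
  have hyy := (((hasDerivAt_boost_space (contDiff_pdt hv) c s t x y).const_mul s).add
    ((hasDerivAt_boost_space (contDiff_pdy hv) c s t x y).const_mul c)).deriv
  have hx (u : ℝ → ℝ → ℝ → ℝ) : pdx (fun t x y => u (c * t + s * y) x (c * y + s * t)) =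
      fun t x y => pdx u (c * t + s * y) x (c * y + s * t) := rfl
  rw [ht, hy]
  simp only [hx]
  have h := hsol (c * t + s * y) x (c * y + s * t)
  refine htt.trans (Eq.trans ?_ (congrArg (_ + ·) hyy.symm))
  linear_combination h + (pdt (pdt v) (c * t + s * y) x (c * y + s * t)
    - pdy (pdy v) (c * t + s * y) x (c * y + s * t)) * hcs
end
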